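/- Nonlinear structure of B (null form plus P decomposition): let d ≥ 1, λ ∈ (0,1], η ∈ (0,1], V ⊆ ℝ^(d+1) open, g_0 a metric on V, and h a smooth symmetric-matrix-valued function on V. Suppose C1 ≥ 1 and that, pointwise on V: |(g_0)_αβ|, |g_0^αβ| ≤ C1; |∂_γ h_αβ| ≤ C1 for all indices; and the wave-coordinate bound |g_0^αα' ∂_α h_βα' − (1/2) g_0^αα' ∂_β h_αα'| ≤ C1 λ^η holds for every β. Then there exists C2 depending only on C1 and d such that pointwise on V, for all μ, ν: |B_μν(g_0)(∂h, ∂h) − Q_μν(g_0)(∂h, ∂h) − P_μν(g_0)(∂h, ∂h)| ≤ C2 λ^η. -/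

import Mathlib

noncomputable section

open MeasureTheory Filter Topology
open scoped ENNReal NNReal

abbrev Vec (d : ℕ) := Fin (d + 1) → ℝ
abbrev SymMat (d : ℕ) := Vec d → Matrix (Fin (d + 1)) (Fin (d + 1)) ℝ
abbrev Met (d : ℕ) := SymMat d
abbrev Phase (d : ℕ) := Vec d × Vec d

/-- Coordinate partial derivative `∂_α`. -/
def pd {d : ℕ} {E : Type*} [NormedAddCommGroup E] [NormedSpace ℝ E]
    (α : Fin (d + 1)) (f : Vec d → E) (x : Vec d) : E :=
  fderiv ℝ f x (Pi.single α 1)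

/-- Entries of the pointwise inverse matrix `g^{αβ}`. -/
def ginv {d : ℕ} (g : Met d) (x : Vec d) : Matrix (Fin (d + 1)) (Fin (d + 1)) ℝ := (g x)⁻¹

/-- Minkowski matrix `diag(-1,1,…,1)`. -/
def mink (d : ℕ) : Matrix (Fin (d + 1)) (Fin (d + 1)) ℝ :=
  Matrix.diagonal (fun α => if α = 0 then (-1 : ℝ) else 1)

/-- A metric on V : smooth entries, symmetric and invertible pointwise on V. -/
def IsMetricOn {d : ℕ} (g : Met d) (V : Set (Vec d)) : Prop :=
  (∀ α β, ContDiffOn ℝ (⊤ : ℕ∞) (fun x => g x α β) V) ∧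
  (∀ x ∈ V, (g x).IsSymm) ∧ (∀ x ∈ V, IsUnit (g x).det)

/-- Christoffel symbol `Γ_{αβμ}(g)`. -/
def Christoffel {d : ℕ} (g : Met d) (α β μ : Fin (d + 1)) (x : Vec d) : ℝ :=
  (1 / 2) * (pd α (fun y => g y μ β) x + pd μ (fun y => g y α β) x - pd β (fun y => g y α μ) x)

/-- Mixed Christoffel symbol `Γ_ρ{}^α{}_μ(g)`. -/
def GammaMix {d : ℕ} (g : Met d) (ρ α μ : Fin (d + 1)) (x : Vec d) : ℝ :=
  ∑ β, ginv g x α β * Christoffel g ρ β μ x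

/-- Coordinate formula for the Ricci curvature. -/
def RicciC {d : ℕ} (g : Met d) (μ ν : Fin (d + 1)) (x : Vec d) : ℝ :=
  (∑ α, ∑ β, ginv g x α β * (pd β (Christoffel g μ α ν) x - pd ν (Christoffel g μ α β) x)) +
  ∑ α, ∑ β, ∑ σ, ∑ ρ, ginv g x α β * ginv g x σ ρ *
    (Christoffel g ν σ α x * Christoffel g μ ρ β x -
      Christoffel g α σ β x * Christoffel g μ ρ ν x)

/-- `H^ρ(g)(∂p)`. -/
def Hgauge {d : ℕ} (g : Met d) (p : SymMat d) (ρ : Fin (d + 1)) (x : Vec d) : ℝ :=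
  ∑ σ, ∑ α, ∑ β, ginv g x ρ σ * ginv g x α β *
    (pd β (fun y => p y σ α) x - (1 / 2) * pd σ (fun y => p y α β) x)

/-- Scalar wave operator `Box_g f = g^{αβ} ∂²_{αβ} f − H^α(g)(∂g) ∂_α f`. -/
def BoxOp {d : ℕ} {E : Type*} [NormedAddCommGroup E] [NormedSpace ℝ E]
    (g : Met d) (f : Vec d → E) (x : Vec d) : E :=
  (∑ α, ∑ β, ginv g x α β • pd α (pd β f) x) - ∑ α, Hgauge g g α x • pd α f x

/-- Fourier transform on `ℝ^n` with the convention `∫ f(x) e^{-i x·ξ} dx`. -/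
def ft {n : ℕ} (f : (Fin n → ℝ) → ℂ) (ξ : Fin n → ℝ) : ℂ :=
  ∫ x : Fin n → ℝ, f x * Complex.exp (-Complex.I * (∑ i, x i * ξ i))

/-- Inverse Fourier transform on `ℝ^n`. -/
def ftInv {n : ℕ} (f : (Fin n → ℝ) → ℂ) (x : Fin n → ℝ) : ℂ :=
  ((((2 * Real.pi) ^ n)⁻¹ : ℝ) : ℂ) *
    ∫ ξ : Fin n → ℝ, f ξ * Complex.exp (Complex.I * (∑ i, x i * ξ i))

/-- Fourier multiplier operator `T_m u = F^{-1}(m · F u)`. -/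
def Tm {n : ℕ} (m : (Fin n → ℝ) → ℝ) (u : (Fin n → ℝ) → ℂ) : (Fin n → ℝ) → ℂ :=
  ftInv (fun ξ => (m ξ : ℂ) * ft u ξ)

/-- Pairing `⟨u,v⟩ = ∫ conj(u) v √|det g| dx`. -/
def pairG {d : ℕ} (g : Met d) (u v : Vec d → ℂ) : ℂ :=
  ∫ x : Vec d, (starRingEnd ℂ) (u x) * v x * ((Real.sqrt |(g x).det| : ℝ) : ℂ)

/-- `m` is smooth away from `0` and positively `0`-homogeneous. -/
def Homog0 {n : ℕ} (m : (Fin n → ℝ) → ℝ) : Prop :=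
  ContDiffOn ℝ (⊤ : ℕ∞) m {(0 : Fin n → ℝ)}ᶜ ∧ ∀ s : ℝ, 0 < s → ∀ ξ, m (s • ξ) = m ξ

/-- Integral of a function against a (finite) signed measure. -/
def sInt {X : Type*} [MeasurableSpace X] (μ : MeasureTheory.SignedMeasure X) (f : X → ℝ) : ℝ :=
  (∫ x, f x ∂μ.toJordanDecomposition.posPart) -
    ∫ x, f x ∂μ.toJordanDecomposition.negPart

/-- Unit sphere `S^d ⊂ ℝ^{d+1}`. -/
def usphere (d : ℕ) : Set (Vec d) := {ξ | ∑ α, ξ α ^ 2 = 1}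

/-- Integral against `dμ := g_0^{αρ} g_0^{βσ} ((1/4) dμ_{ρβασ} − (1/8) dμ_{ραβσ})`. -/
def muInt {d : ℕ} (g0 : Met d)
    (μm : Fin (d + 1) → Fin (d + 1) → Fin (d + 1) → Fin (d + 1) →
      MeasureTheory.SignedMeasure (Phase d))
    (c : Phase d → ℝ) : ℝ :=
  ∑ α, ∑ β, ∑ ρ, ∑ σ,
    ((1 / 4) * sInt (μm ρ β α σ) (fun p => ginv g0 p.1 α ρ * ginv g0 p.1 β σ * c p) -
     (1 / 8) * sInt (μm ρ α β σ) (fun p => ginv g0 p.1 α ρ * ginv g0 p.1 β σ * c p))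

/-- `∂_{x^μ}` on phase space. -/
def pdx {d : ℕ} (μ : Fin (d + 1)) (F : Phase d → ℝ) (p : Phase d) : ℝ :=
  fderiv ℝ F p (Pi.single μ 1, 0)

/-- `∂_{ξ_μ}` on phase space. -/
def pdxi {d : ℕ} (μ : Fin (d + 1)) (F : Phase d → ℝ) (p : Phase d) : ℝ :=
  fderiv ℝ F p (0, Pi.single μ 1)

/-- `g_0^{μν} ξ_μ ξ_ν` as a function on phase space. -/
def Gq {d : ℕ} (g0 : Met d) (p : Phase d) : ℝ := ∑ μ, ∑ ν, ginv g0 p.1 μ ν * p.2 μ * p.2 ν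

/-- Poisson bracket `{F,G} = ∂_{ξ_μ}F ∂_{x^μ}G − ∂_{x^μ}F ∂_{ξ_μ}G`. -/
def pbracket {d : ℕ} (F G : Phase d → ℝ) (p : Phase d) : ℝ :=
  ∑ μ, (pdxi μ F p * pdx μ G p - pdx μ F p * pdxi μ G p)

/-- The `X^p_λ(g)` norm. -/
def XNorm {d : ℕ} (p : ℝ≥0∞) (lam : ℝ) (g : Met d) (f : Vec d → ℂ) : ℝ :=
  lam⁻¹ * (eLpNorm f p volume).toReal +
  (∑ α, (eLpNorm (pd α f) p volume).toReal) +
  lam * (∑ α, ∑ β, (eLpNorm (pd α (pd β f)) p volume).toReal) +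
  (eLpNorm (BoxOp g f) p volume).toReal

/-- Null form `𝔔_0^{(g)}` (complex-valued). -/
def Q0C {d : ℕ} (g : Met d) (φ ψ : Vec d → ℂ) (x : Vec d) : ℂ :=
  ∑ α, ∑ β, ((ginv g x α β : ℝ) : ℂ) * pd α φ x * pd β ψ x

/-- Null form `𝔔_{μν}` (complex-valued). -/
def QmnC {d : ℕ} (μ ν : Fin (d + 1)) (φ ψ : Vec d → ℂ) (x : Vec d) : ℂ :=
  pd μ φ x * pd ν ψ x - pd ν φ x * pd μ ψ x

/-- Null form `𝔔_0^{(g)}` (real-valued). -/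
def Q0R {d : ℕ} (g : Met d) (φ ψ : Vec d → ℝ) (x : Vec d) : ℝ :=
  ∑ α, ∑ β, ginv g x α β * pd α φ x * pd β ψ x

/-- Null form `𝔔_{μν}` (real-valued). -/
def QmnR {d : ℕ} (μ ν : Fin (d + 1)) (φ ψ : Vec d → ℝ) (x : Vec d) : ℝ :=
  pd μ φ x * pd ν ψ x - pd ν φ x * pd μ ψ x

/-- The quadratic form `B_{μν}(g)(∂p, ∂q)` (symmetrizations written out). -/
def Bq {d : ℕ} (g : Met d) (p q : SymMat d) (μ ν : Fin (d + 1)) (x : Vec d) : ℝ :=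
  ∑ α, ∑ β, ∑ σ, ∑ ρ, ginv g x α β * ginv g x σ ρ *
    ((pd μ (fun y => p y β ρ) x * pd σ (fun y => q y ν α) x +
      pd ν (fun y => p y β ρ) x * pd σ (fun y => q y μ α) x) -
     (1 / 4) * (pd μ (fun y => p y β ρ) x * pd ν (fun y => q y α σ) x +
                pd ν (fun y => p y β ρ) x * pd μ (fun y => q y α σ) x) +
     pd σ (fun y => p y ν α) x * pd ρ (fun y => q y μ β) x -
     pd α (fun y => p y ν σ) x * pd ρ (fun y => q y μ β) x)

/-- `D_μ^{ασ}(g_0)`. -/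
def Dcoef {d : ℕ} (g0 : Met d) (μ α σ : Fin (d + 1)) (x : Vec d) : ℝ :=
  ∑ β, ∑ ρ, ginv g0 x α β * ginv g0 x σ ρ *
    (2 * pd ρ (fun y => g0 y β μ) x - pd μ (fun y => g0 y β ρ) x)

/-- `L_{μν}(g_0)(∂h)`. -/
def Lq {d : ℕ} (g0 : Met d) (h : SymMat d) (μ ν : Fin (d + 1)) (x : Vec d) : ℝ :=
  2 * (∑ σ, ∑ ρ, ∑ α, ginv g0 x σ ρ *
        (GammaMix g0 ρ α μ x * pd σ (fun y => h y ν α) x +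
         GammaMix g0 ρ α ν x * pd σ (fun y => h y μ α) x)) +
  (1 / 2) * (∑ α, ∑ σ, (Dcoef g0 μ α σ x * pd ν (fun y => h y α σ) x +
                        Dcoef g0 ν α σ x * pd μ (fun y => h y α σ) x))

/-- `Q_{μν}(g_0)(∂h, ∂h)`. -/
def Qq {d : ℕ} (g0 : Met d) (h : SymMat d) (μ ν : Fin (d + 1)) (x : Vec d) : ℝ :=
  (∑ α, ∑ β, ginv g0 x α β * Q0R g0 (fun y => h y ν α) (fun y => h y μ β) x) +
  ∑ α, ∑ β, ∑ σ, ∑ ρ, ginv g0 x α β * ginv g0 x σ ρ *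
    ((1 / 2) * (QmnR β μ (fun y => h y σ ρ) (fun y => h y ν α) x +
                QmnR β ν (fun y => h y σ ρ) (fun y => h y μ α) x) +
     (QmnR μ σ (fun y => h y β ρ) (fun y => h y ν α) x +
      QmnR ν σ (fun y => h y β ρ) (fun y => h y μ α) x) -
     QmnR α ρ (fun y => h y ν σ) (fun y => h y μ β) x)

/-- `P_{μν}(g_0)(∂h, ∂h)`. -/
def Pq {d : ℕ} (g0 : Met d) (h : SymMat d) (μ ν : Fin (d + 1)) (x : Vec d) : ℝ :=
  (1 / 4) * (∑ α, ∑ α', ginv g0 x α α' * pd μ (fun y => h y α α') x) *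
            (∑ β, ∑ β', ginv g0 x β β' * pd ν (fun y => h y β β') x) -
  (1 / 2) * ∑ α, ∑ α', ∑ β, ∑ β', ginv g0 x α α' * pd μ (fun y => h y α β) x *
            ginv g0 x β β' * pd ν (fun y => h y α' β') x

/-- Euclidean norm on `ℝ^n`. -/
def enormV {n : ℕ} (ξ : Fin n → ℝ) : ℝ := Real.sqrt (∑ i, ξ i ^ 2)

/-- The angle quantity `Ξ_{ι1 ι2}(θ,η)`. -/
def XiAng (ι1 ι2 : ℝ) (θ η : Fin 3 → ℝ) : ℝ :=
  Real.sqrt (2 * (enormV θ * enormV η - ι1 * ι2 * ∑ i, θ i * η i) / (enormV θ * enormV η))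

/-- The phase `Φ_{ι ι1 ι2}(ξ,η)`. -/
def PhiPh (ι ι1 ι2 : ℝ) (ξ η : Fin 3 → ℝ) : ℝ :=
  ι * enormV ξ - ι1 * enormV (ξ - η) - ι2 * enormV η

/-- Littlewood–Paley projection on `ℝ³` built from `ψLP`. -/
def LPProj (ψLP : (Fin 3 → ℝ) → ℝ) (k : ℤ) (f : (Fin 3 → ℝ) → ℂ) : (Fin 3 → ℝ) → ℂ :=
  ftInv (fun ξ => (ψLP ((2 : ℝ) ^ (-k) • ξ) : ℂ) * ft f ξ)

/-- A standard Littlewood–Paley bump. -/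
def GoodLP (ψLP : (Fin 3 → ℝ) → ℝ) : Prop :=
  ContDiff ℝ (⊤ : ℕ∞) ψLP ∧ (∀ ξ, ψLP ξ ∈ Set.Icc (0 : ℝ) 1) ∧
  (∀ ξ ζ, enormV ξ = enormV ζ → ψLP ξ = ψLP ζ) ∧
  (Function.support ψLP ⊆ {ξ | 1 / 2 ≤ enormV ξ ∧ enormV ξ ≤ 2}) ∧
  (∀ ξ : Fin 3 → ℝ, ξ ≠ 0 → ∑' k : ℤ, ψLP ((2 : ℝ) ^ (-k) • ξ) = 1)

/-- Admissible symbols of Ionescu–Pausader type. -/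
def AdmSymbol (m : (Fin 3 → ℝ) → (Fin 3 → ℝ) → ℝ) : Prop :=
  (∃ i j : Fin 3, ∀ θ η, m θ η = (θ i * η j - θ j * η i) / (enormV θ * enormV η)) ∨
  (∃ j : Fin 3, ∀ θ η, m θ η = η j / enormV η - θ j / enormV θ)

/-- Spatial part of a spacetime point. -/
def spat (x : Vec 3) : Fin 3 → ℝ := fun i => x i.succ

/-- Reassemble a spacetime point from its time and space parts. -/
def glue (t : ℝ) (y : Fin 3 → ℝ) : Vec 3 := Fin.cons t y

/-- Spatial Littlewood–Paley projection on `ℝ^{1+3}`. -/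
def LPsp (ψLP : (Fin 3 → ℝ) → ℝ) (k : ℤ) (u : Vec 3 → ℂ) (x : Vec 3) : ℂ :=
  ftInv (fun ξ => (ψLP ((2 : ℝ) ^ (-k) • ξ) : ℂ) * ft (fun y => u (glue (x 0) y)) ξ) (spat x)

/-- Minkowski wave operator on `ℝ^{1+3}`. -/
def BoxMink (u : Vec 3 → ℂ) (x : Vec 3) : ℂ :=
  - pd 0 (pd 0 u) x + ∑ i : Fin 3, pd i.succ (pd i.succ u) x

/-- Flat pairing `⟨u,v⟩ = ∫ conj(u) v`. -/
def pairF (u v : Vec 3 → ℂ) : ℂ := ∫ x : Vec 3, (starRingEnd ℂ) (u x) * v x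

/-- `Σ_α ‖∂_α φ‖_{L^p}`. -/
def dNorm (p : ℝ≥0∞) (φ : Vec 3 → ℂ) : ℝ := ∑ α, (eLpNorm (pd α φ) p volume).toReal

/-- Covector `dt − 𝔞_i dx^i`. -/
def cov1 (af : Fin 3 → Vec 3 → ℝ) (x : Vec 3) : Fin (3 + 1) → ℝ :=
  Fin.cons 1 (fun i => - af i x)

/-- Covector `dx^i + 𝔟^i dt + 𝔅^i_j dx^j`. -/
def cov2 (bf : Fin 3 → Vec 3 → ℝ) (Bf : Fin 3 → Fin 3 → Vec 3 → ℝ) (i : Fin 3) (x : Vec 3) :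
    Fin (3 + 1) → ℝ :=
  Fin.cons (bf i x) (fun j => (if j = i then (1 : ℝ) else 0) + Bf i j x)

/-- Matrix of the quadratic form `−𝔑 (dt − 𝔞_i dx^i)² + Σ_i 𝔠_i (dx^i + 𝔟^i dt + 𝔅^i_j dx^j)²`. -/
def met4 (Nf : Vec 3 → ℝ) (af bf cf : Fin 3 → Vec 3 → ℝ) (Bf : Fin 3 → Fin 3 → Vec 3 → ℝ) :
    Met 3 :=
  fun x => Matrix.of fun α β =>
    - Nf x * cov1 af x α * cov1 af x β + ∑ i, cf i x * cov2 bf Bf i x α * cov2 bf Bf i x β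


section Contraction

variable {ι : Type*} [Fintype ι]

/-- The contraction `G^{αα'} D_{α;βα'} - (1/2) G^{αα'} D_{β;αα'}`, where `D_{γ;αβ}` stands for
`∂_γ h_{αβ}`; it vanishes in wave coordinates. -/
def waveDefect (G : ι → ι → ℝ) (D : ι → ι → ι → ℝ) (β : ι) : ℝ :=
  (∑ α, ∑ α', G α α' * D α β α') - (1 / 2) * ∑ α, ∑ α', G α α' * D β α α'

theorem sum_sum_symm_mul {G : ι → ι → ℝ} (hG : ∀ α β, G α β = G β α) (F : ι → ι → ℝ) :
    ∑ α, ∑ β, G α β * F β α = ∑ α, ∑ β, G α β * F α β := by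
  rw [Finset.sum_comm]
  exact Finset.sum_congr rfl fun α _ => Finset.sum_congr rfl fun β _ => by rw [hG]

theorem sum_four_mul (A B : ι → ι → ℝ) :
    ∑ α, ∑ β, ∑ σ, ∑ ρ, A α β * B σ ρ = (∑ α, ∑ β, A α β) * ∑ σ, ∑ ρ, B σ ρ := by
  rw [Finset.sum_mul]
  refine Finset.sum_congr rfl fun α _ => ?_
  rw [Finset.sum_mul]
  simp only [Finset.mul_sum]

/-- Up to terms containing `waveDefect`, the non-null part of the quadratic form `B_{μν}`
is `P_{μν}`. -/
theorem contraction_sub_null_eq {G : ι → ι → ℝ} (hG : ∀ α β, G α β = G β α)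
    (D : ι → ι → ι → ℝ) (μ ν : ι) :
    (∑ α, ∑ β, ∑ σ, ∑ ρ, G α β * G σ ρ *
      ((D μ β ρ * D σ ν α + D ν β ρ * D σ μ α) -
        (1 / 4) * (D μ β ρ * D ν α σ + D ν β ρ * D μ α σ) +
        D σ ν α * D ρ μ β - D α ν σ * D ρ μ β)) -
    ((∑ α, ∑ β, G α β * ∑ σ, ∑ ρ, G σ ρ * D σ ν α * D ρ μ β) +
      ∑ α, ∑ β, ∑ σ, ∑ ρ, G α β * G σ ρ *
        ((1 / 2) * ((D β σ ρ * D μ ν α - D μ σ ρ * D β ν α) +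
            (D β σ ρ * D ν μ α - D ν σ ρ * D β μ α)) +
          ((D μ β ρ * D σ ν α - D σ β ρ * D μ ν α) +
            (D ν β ρ * D σ μ α - D σ β ρ * D ν μ α)) -
          (D α ν σ * D ρ μ β - D ρ ν σ * D α μ β))) -
    ((1 / 4) * (∑ α, ∑ α', G α α' * D μ α α') * (∑ β, ∑ β', G β β' * D ν β β') -
      (1 / 2) * ∑ α, ∑ α', ∑ β, ∑ β', G α α' * D μ α β * G β β' * D ν α' β') =
    (∑ α, ∑ β, G α β * waveDefect G D β * (D μ ν α + D ν μ α)) -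
      waveDefect G D μ * waveDefect G D ν := by
  have hnull : ∑ α, ∑ β, G α β * ∑ σ, ∑ ρ, G σ ρ * D σ ν α * D ρ μ β =
      ∑ α, ∑ β, ∑ σ, ∑ ρ, G α β * G σ ρ * (D σ ν α * D ρ μ β) := by
    simp only [Finset.mul_sum, mul_assoc]
  have hswap : ∑ α, ∑ β, ∑ σ, ∑ ρ, G α β * G σ ρ * (D μ β ρ * D ν α σ) =
      ∑ α, ∑ α', ∑ β, ∑ β', G α α' * D μ α β * G β β' * D ν α' β' := by
    rw [Finset.sum_comm]
    refine Finset.sum_congr rfl fun α _ => Finset.sum_congr rfl fun β _ => ?_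
    rw [Finset.sum_comm]
    refine Finset.sum_congr rfl fun σ _ => Finset.sum_congr rfl fun ρ _ => ?_
    rw [hG β α, hG ρ σ]; ring
  have hdirect : ∑ α, ∑ β, ∑ σ, ∑ ρ, G α β * G σ ρ * (D ν β ρ * D μ α σ) =
      ∑ α, ∑ α', ∑ β, ∑ β', G α α' * D μ α β * G β β' * D ν α' β' := by
    refine Finset.sum_congr rfl fun α _ => Finset.sum_congr rfl fun β _ =>
      Finset.sum_congr rfl fun σ _ => Finset.sum_congr rfl fun ρ _ => ?_
    ring
  have hdiv : ∑ α, ∑ β, ∑ σ, ∑ ρ, G α β * G σ ρ * (D ρ ν σ * D α μ β) =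
      (∑ α, ∑ β, G α β * D α μ β) * ∑ α, ∑ β, G α β * D α ν β := by
    rw [← sum_sum_symm_mul hG fun α β => D α ν β, ← sum_four_mul]
    refine Finset.sum_congr rfl fun α _ => Finset.sum_congr rfl fun β _ =>
      Finset.sum_congr rfl fun σ _ => Finset.sum_congr rfl fun ρ _ => ?_
    ring
  have htrace : ∀ κ τ, ∑ α, ∑ β, ∑ σ, ∑ ρ, G α β * G σ ρ * (D κ σ ρ * D β τ α) =
      (∑ α, ∑ β, G α β * D α τ β) * ∑ α, ∑ β, G α β * D κ α β := by
    intro κ τ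
    rw [← sum_sum_symm_mul hG fun α β => D α τ β, ← sum_four_mul]
    refine Finset.sum_congr rfl fun α _ => Finset.sum_congr rfl fun β _ =>
      Finset.sum_congr rfl fun σ _ => Finset.sum_congr rfl fun ρ _ => ?_
    ring
  have hdefect : ∑ α, ∑ β, G α β * waveDefect G D β * (D μ ν α + D ν μ α) =
      ∑ α, ∑ β, ∑ σ, ∑ ρ, G α β * G σ ρ *
        ((D σ β ρ - (1 / 2) * D β σ ρ) * (D μ ν α + D ν μ α)) := by
    refine Finset.sum_congr rfl fun α _ => Finset.sum_congr rfl fun β _ => ?_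
    simp only [waveDefect, Finset.mul_sum, Finset.sum_mul, mul_sub, sub_mul,
      Finset.sum_sub_distrib]
    congr 1 <;> refine Finset.sum_congr rfl fun σ _ => Finset.sum_congr rfl fun ρ _ => ?_ <;> ring
  have hsplit : ∑ α, ∑ β, ∑ σ, ∑ ρ, G α β * G σ ρ *
      ((D μ β ρ * D σ ν α + D ν β ρ * D σ μ α) -
        (1 / 4) * (D μ β ρ * D ν α σ + D ν β ρ * D μ α σ) +
        D σ ν α * D ρ μ β - D α ν σ * D ρ μ β) =
      (∑ α, ∑ β, ∑ σ, ∑ ρ, G α β * G σ ρ * (D σ ν α * D ρ μ β)) +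
      (∑ α, ∑ β, ∑ σ, ∑ ρ, G α β * G σ ρ *
        ((1 / 2) * ((D β σ ρ * D μ ν α - D μ σ ρ * D β ν α) +
            (D β σ ρ * D ν μ α - D ν σ ρ * D β μ α)) +
          ((D μ β ρ * D σ ν α - D σ β ρ * D μ ν α) +
            (D ν β ρ * D σ μ α - D σ β ρ * D ν μ α)) -
          (D α ν σ * D ρ μ β - D ρ ν σ * D α μ β))) +
      (∑ α, ∑ β, ∑ σ, ∑ ρ, G α β * G σ ρ *
        ((D σ β ρ - (1 / 2) * D β σ ρ) * (D μ ν α + D ν μ α))) -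
      (∑ α, ∑ β, ∑ σ, ∑ ρ, G α β * G σ ρ * (D ρ ν σ * D α μ β)) +
      (1 / 2) * ((∑ α, ∑ β, ∑ σ, ∑ ρ, G α β * G σ ρ * (D μ σ ρ * D β ν α)) +
        ∑ α, ∑ β, ∑ σ, ∑ ρ, G α β * G σ ρ * (D ν σ ρ * D β μ α)) -
      (1 / 4) * ((∑ α, ∑ β, ∑ σ, ∑ ρ, G α β * G σ ρ * (D μ β ρ * D ν α σ)) +
        ∑ α, ∑ β, ∑ σ, ∑ ρ, G α β * G σ ρ * (D ν β ρ * D μ α σ)) := by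
    simp only [Finset.mul_sum, ← Finset.sum_add_distrib, ← Finset.sum_sub_distrib]
    refine Finset.sum_congr rfl fun α _ => Finset.sum_congr rfl fun β _ =>
      Finset.sum_congr rfl fun σ _ => Finset.sum_congr rfl fun ρ _ => ?_
    ring
  rw [hsplit, hnull, hdefect, hdiv, htrace, htrace, hswap, hdirect, waveDefect, waveDefect]
  ring

theorem abs_waveDefect_contraction_le {G : ι → ι → ℝ} {D : ι → ι → ι → ℝ} {C ε : ℝ}
    (hC : 0 ≤ C) (hε : 0 ≤ ε) (hε1 : ε ≤ 1) (hG : ∀ α β, |G α β| ≤ C)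
    (hD : ∀ γ α β, |D γ α β| ≤ C) (hW : ∀ β, |waveDefect G D β| ≤ C * ε) (μ ν : ι) :
    |(∑ α, ∑ β, G α β * waveDefect G D β * (D μ ν α + D ν μ α)) -
      waveDefect G D μ * waveDefect G D ν| ≤
      (2 * Fintype.card ι ^ 2 * C ^ 3 + C ^ 2) * ε := by
  have hterm : ∀ α β, |G α β * waveDefect G D β * (D μ ν α + D ν μ α)| ≤
      C * (C * ε) * (C + C) := fun α β => by
    rw [abs_mul, abs_mul]
    gcongr
    · exact hG α β
    · exact hW β
    · exact (abs_add_le _ _).trans (add_le_add (hD _ _ _) (hD _ _ _))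
  have hsum : |∑ α, ∑ β, G α β * waveDefect G D β * (D μ ν α + D ν μ α)| ≤
      ∑ _α : ι, ∑ _β : ι, C * (C * ε) * (C + C) :=
    (Finset.abs_sum_le_sum_abs _ _).trans <| Finset.sum_le_sum fun α _ =>
      (Finset.abs_sum_le_sum_abs _ _).trans <| Finset.sum_le_sum fun β _ => hterm α β
  have hprod : |waveDefect G D μ * waveDefect G D ν| ≤ C ^ 2 * ε := by
    calc |waveDefect G D μ * waveDefect G D ν| ≤ (C * ε) * (C * ε) := by
          rw [abs_mul]
          gcongr
          exacts [hW μ, hW ν]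
      _ = C ^ 2 * ε * ε := by ring
      _ ≤ C ^ 2 * ε := mul_le_of_le_one_right (by positivity) hε1
  refine (abs_sub _ _).trans ((add_le_add hsum hprod).trans_eq ?_)
  simp only [Finset.sum_const, Finset.card_univ, nsmul_eq_mul]
  ring

end Contraction

theorem ginv_symm {d : ℕ} {g : Met d} {x : Vec d} (hg : (g x).IsSymm) (α β : Fin (d + 1)) :
    ginv g x α β = ginv g x β α :=
  hg.inv.apply β α

/-- Nonlinear structure of `B`: null form plus `P` decomposition. -/
theorem stmt14
    (d : ℕ) (hd : 1 ≤ d) (C1 : ℝ) (hC1 : 1 ≤ C1) :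
    ∃ C2 : ℝ, ∀ lam : ℝ, lam ∈ Set.Ioc (0 : ℝ) 1 → ∀ eta : ℝ, eta ∈ Set.Ioc (0 : ℝ) 1 →
      ∀ V : Set (Vec d), IsOpen V →
      ∀ g0 : Met d, IsMetricOn g0 V →
      ∀ h : SymMat d,
      (∀ α β, ContDiffOn ℝ (⊤ : ℕ∞) (fun x => h x α β) V) →
      (∀ x ∈ V, (h x).IsSymm) →
      (∀ x ∈ V, ∀ α β : Fin (d + 1), |g0 x α β| ≤ C1 ∧ |ginv g0 x α β| ≤ C1) →
      (∀ x ∈ V, ∀ γ α β : Fin (d + 1), |pd γ (fun y => h y α β) x| ≤ C1) →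
      (∀ x ∈ V, ∀ β : Fin (d + 1),
        |(∑ α, ∑ α', ginv g0 x α α' * pd α (fun y => h y β α') x) -
          (1 / 2) * ∑ α, ∑ α', ginv g0 x α α' * pd β (fun y => h y α α') x| ≤ C1 * lam ^ eta) →
      ∀ x ∈ V, ∀ μ ν : Fin (d + 1),
        |Bq g0 h h μ ν x - Qq g0 h μ ν x - Pq g0 h μ ν x| ≤ C2 * lam ^ eta := by
  refine ⟨2 * Fintype.card (Fin (d + 1)) ^ 2 * C1 ^ 3 + C1 ^ 2, ?_⟩
  intro lam hlam eta heta V _ g0 hg0 h _ _ hbound hD hW x hx μ ν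
  have hid := contraction_sub_null_eq (ginv_symm (hg0.2.1 x hx))
    (fun γ α β => pd γ (fun y => h y α β) x) μ ν
  have hle := abs_waveDefect_contraction_le (zero_le_one.trans hC1)
    (Real.rpow_nonneg hlam.1.le eta) (Real.rpow_le_one hlam.1.le hlam.2 heta.1.le)
    (fun α β => (hbound x hx α β).2) (hD x hx) (hW x hx) μ ν
  rw [← hid] at hle
  exact hle

end
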